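/- Fix a finite vertex set V with root r ∈ V, and let g be the sever-graft involution on triples (G, v, u) (G a directed tree on V rooted at r, v ≠ r, u not a descendant of v in G). Then for any two directed trees G and G' on V rooted at r, there exists a finite sequence of triples (G₀, v₀, u₀), …, (G_k, v_k, u_k) such that: (i) for each i = 0, …, k−1, the triple (Gᵢ, vᵢ, uᵢ) lies in the domain of g; (ii) G₀ = G; (iii) G_k = G'; and (iv) for each i < k, G_{i+1} is the first component of g(Gᵢ, vᵢ, uᵢ). In other words, any rooted tree on V can be transformed into any other by a finite sequence of sever-graft moves. -/

import Mathlib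

/-- `p` is a directed path from `a` to `b` in the directed graph with edge
relation `E`. -/
def IsDirPath {V : Type*} (E : V → V → Prop) (a b : V) (p : List V) : Prop :=
  p.head? = some a ∧ p.getLast? = some b ∧ p.Chain' E

/-- A directed graph (given by its edge relation `E`) on `V` is a directed tree
rooted at `r` if for every vertex `w` there is a unique directed path from `r` to `w`. -/
def IsDirTree {V : Type*} (E : V → V → Prop) (r : V) : Prop :=
  ∀ w : V, ∃! p : List V, IsDirPath E r w p

/-- `w` is a descendant of `v` (including `v` itself): there is a directed path
from `v` to `w`. -/
def Descendant {V : Type*} (E : V → V → Prop) (v w : V) : Prop :=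
  ∃ p : List V, IsDirPath E v w p

/-- The edge relation obtained from `E` by deleting the edge `(u', v)` and adding
the edge `(u, v)` (the sever-graft move with sever vertex `v` and graft vertex `u`,
where `u'` is the parent of `v`). -/
def SevGraft {V : Type*} (E : V → V → Prop) (u' u v : V) : V → V → Prop :=
  fun a b => (E a b ∧ ¬(a = u' ∧ b = v)) ∨ (a = u ∧ b = v)

theorem IsDirPath.concat {V : Type*} {E : V → V → Prop} {a b c : V} {p : List V}
    (hp : IsDirPath E a b p) (h : E b c) : IsDirPath E a c (p ++ [c]) := by
  obtain ⟨hhead, hlast, hchain⟩ := hp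
  refine ⟨by simp [List.head?_append, hhead], by simp, ?_⟩
  refine List.isChain_append.2 ⟨hchain, List.isChain_singleton _, ?_⟩
  simp [hlast, h]

theorem descendant_iff_reflTransGen {V : Type*} {E : V → V → Prop} {v w : V} :
    Descendant E v w ↔ Relation.ReflTransGen E v w := by
  constructor
  · rintro ⟨p, hp⟩
    induction p using List.reverseRecOn generalizing w with
    | nil => simp [IsDirPath] at hp
    | append_singleton q c ih =>
      obtain ⟨hhead, hlast, hchain⟩ := hp
      obtain rfl : c = w := by simpa using hlast
      obtain ⟨hq, -, hqc⟩ := List.isChain_append.1 hchain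
      rcases hb : q.getLast? with _ | b
      · obtain rfl := List.getLast?_eq_none_iff.1 hb
        obtain rfl : c = v := by simpa using hhead
        exact .refl
      · have hqv : q.head? = some v := by
          cases q with
          | nil => simp at hb
          | cons x t => simpa using hhead
        exact (ih ⟨hqv, hb, hq⟩).tail (hqc b hb c rfl)
  · intro h
    induction h with
    | refl => exact ⟨[v], rfl, rfl, List.isChain_singleton _⟩
    | tail _ h ih =>
      obtain ⟨p, hp⟩ := ih
      exact ⟨_, hp.concat h⟩

theorem IsDirTree.reflTransGen {V : Type*} {E : V → V → Prop} {r : V}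
    (hE : IsDirTree E r) (w : V) : Relation.ReflTransGen E r w :=
  descendant_iff_reflTransGen.1 (hE w).exists

theorem IsDirTree.not_edge_root {V : Type*} {E : V → V → Prop} {r : V}
    (hE : IsDirTree E r) (a : V) : ¬ E a r := by
  intro h
  obtain ⟨p, hp⟩ := (hE a).exists
  have := (hE r).unique (hp.concat h) ⟨rfl, rfl, List.isChain_singleton _⟩
  obtain rfl : p = [] := by simpa using this
  simp [IsDirPath] at hp

theorem IsDirTree.parent_unique {V : Type*} {E : V → V → Prop} {r : V}
    (hE : IsDirTree E r) {a b v : V} (ha : E a v) (hb : E b v) : a = b := by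
  obtain ⟨p, hp⟩ := (hE a).exists
  obtain ⟨q, hq⟩ := (hE b).exists
  have := (hE v).unique (hp.concat ha) (hq.concat hb)
  obtain rfl : p = q := by simpa using this
  simpa using hp.2.1.symm.trans hq.2.1

theorem IsDirTree.exists_parent {V : Type*} {E : V → V → Prop} {r v : V}
    (hE : IsDirTree E r) (hv : v ≠ r) : ∃ a, E a v := by
  rcases (hE.reflTransGen v).cases_tail with h | ⟨a, -, h⟩
  · exact absurd h hv
  · exact ⟨a, h⟩

theorem IsDirTree.not_transGen_self {V : Type*} {E : V → V → Prop} {r : V}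
    (hE : IsDirTree E r) (w : V) : ¬ Relation.TransGen E w w := by
  induction hE.reflTransGen w with
  | refl =>
    intro h
    obtain ⟨a, -, h⟩ := Relation.TransGen.tail'_iff.1 h
    exact hE.not_edge_root a h
  | @tail b c _ hbc ih =>
    intro h
    obtain ⟨a, hca, hac⟩ := Relation.TransGen.tail'_iff.1 h
    obtain rfl := hE.parent_unique hac hbc
    exact ih (Relation.TransGen.head' hbc hca)

theorem isDirTree_of_reflTransGen {V : Type*} {E : V → V → Prop} {r : V}
    (hroot : ∀ a, ¬ E a r) (huniq : ∀ a b v, E a v → E b v → a = b)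
    (hreach : ∀ w, Relation.ReflTransGen E r w) : IsDirTree E r := by
  have hunique : ∀ (p q : List V) (w : V), IsDirPath E r w p → IsDirPath E r w q → p = q := by
    intro p
    induction p using List.reverseRecOn with
    | nil => intro q w hp; simp [IsDirPath] at hp
    | append_singleton p c ih =>
      intro q w hp hq
      induction q using List.reverseRecOn with
      | nil => simp [IsDirPath] at hq
      | append_singleton q d _ =>
        obtain ⟨hp1, hp2, hp3⟩ := hp
        obtain ⟨hq1, hq2, hq3⟩ := hq
        obtain rfl : c = w := by simpa using hp2
        obtain rfl : d = c := by simpa using hq2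
        obtain ⟨hp4, -, hp5⟩ := List.isChain_append.1 hp3
        obtain ⟨hq4, -, hq5⟩ := List.isChain_append.1 hq3
        rcases hb : p.getLast? with _ | a <;> rcases hb' : q.getLast? with _ | b
        · rw [List.getLast?_eq_none_iff.1 hb, List.getLast?_eq_none_iff.1 hb']
        · obtain rfl := List.getLast?_eq_none_iff.1 hb
          obtain rfl : d = r := by simpa using hp1
          exact absurd (hq5 b hb' d rfl) (hroot b)
        · obtain rfl := List.getLast?_eq_none_iff.1 hb'
          obtain rfl : d = r := by simpa using hq1
          exact absurd (hp5 a hb d rfl) (hroot a)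
        · obtain rfl := huniq _ _ _ (hp5 a hb d rfl) (hq5 b hb' d rfl)
          have hp6 : p.head? = some r := by
            cases p with
            | nil => simp at hb
            | cons x t => simpa using hp1
          have hq6 : q.head? = some r := by
            cases q with
            | nil => simp at hb'
            | cons x t => simpa using hq1
          rw [ih q a ⟨hp6, hb, hp4⟩ ⟨hq6, hb', hq4⟩]
  intro w
  obtain ⟨p, hp⟩ := descendant_iff_reflTransGen.2 (hreach w)
  exact ⟨p, hp, fun q hq => hunique q p w hq hp⟩

theorem IsDirTree.sevGraft {V : Type*} {E : V → V → Prop} {r u' u v : V}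
    (hE : IsDirTree E r) (hv : v ≠ r) (hu : ¬ Descendant E v u) (hu' : E u' v) :
    IsDirTree (SevGraft E u' u v) r := by
  rw [descendant_iff_reflTransGen] at hu
  have hedge : ∀ b c, E b c → c ≠ v → SevGraft E u' u v b c :=
    fun b c h hc => .inl ⟨h, fun h => hc h.2⟩
  have hnondesc : ∀ w, ¬ Relation.ReflTransGen E v w →
      Relation.ReflTransGen (SevGraft E u' u v) r w := by
    intro w
    induction hE.reflTransGen w with
    | refl => exact fun _ => .refl
    | @tail b c _ hbc ih =>
      intro hc
      refine (ih fun h => hc (h.tail hbc)).tail (hedge b c hbc ?_)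
      rintro rfl
      exact hc .refl
  have hreach : Relation.ReflTransGen (SevGraft E u' u v) r v :=
    (hnondesc u hu).tail (.inr ⟨rfl, rfl⟩)
  refine isDirTree_of_reflTransGen ?_ ?_ ?_
  · rintro a (⟨h, -⟩ | ⟨-, h⟩)
    · exact hE.not_edge_root a h
    · exact hv h.symm
  · rintro a b w (⟨h, h₁⟩ | ⟨ha, hw⟩) (⟨h', h₂⟩ | ⟨hb, hw'⟩)
    · exact hE.parent_unique h h'
    · exact absurd ⟨hE.parent_unique (hw' ▸ h) hu', hw'⟩ h₁
    · exact absurd ⟨hE.parent_unique (hw ▸ h') hu', hw⟩ h₂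
    · exact ha.trans hb.symm
  · intro w
    by_cases hw : Relation.ReflTransGen E v w
    · induction hw with
      | refl => exact hreach
      | @tail b c _ hbc ih =>
        by_cases hc : c = v
        · exact hc ▸ hreach
        · exact ih.tail (hedge b c hbc hc)
    · exact hnondesc w hw

/-- A directed tree containing all edges of another directed tree with the same root equals it. -/
theorem IsDirTree.eq_of_le {V : Type*} {E E' : V → V → Prop} {r : V} (hE : IsDirTree E r)
    (hE' : IsDirTree E' r) (h : ∀ w a, E' a w → E a w) : E = E' := by
  ext a w
  refine ⟨fun haw => ?_, h w a⟩
  have hw : w ≠ r := by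
    rintro rfl
    exact hE.not_edge_root a haw
  obtain ⟨b, hb⟩ := hE'.exists_parent hw
  exact hE.parent_unique haw (h w b hb) ▸ hb

/-- If `E` and `E'` agree on the parents of all `E'`-ancestors of `b`, then every `E`-ancestor
of `b` is an `E'`-ancestor. -/
theorem IsDirTree.reflTransGen_of_ancestors {V : Type*} {E E' : V → V → Prop} {r x b : V}
    (hE : IsDirTree E r) (hE' : IsDirTree E' r)
    (hb : ∀ y, Relation.ReflTransGen E' y b → ∀ a, E' a y → E a y)
    (h : Relation.ReflTransGen E x b) : Relation.ReflTransGen E' x b := by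
  induction h with
  | refl => exact .refl
  | @tail y b _ hyb ih =>
    have hbr : b ≠ r := by
      rintro rfl
      exact hE.not_edge_root y hyb
    obtain ⟨y', hy'⟩ := hE'.exists_parent hbr
    obtain rfl := hE.parent_unique hyb (hb b .refl y' hy')
    exact (ih fun z hz => hb z (hz.tail hy')).tail hy'

/-- Distinct directed trees admit a sever-graft move giving some vertex its target parent. -/
theorem IsDirTree.exists_move {V : Type*} {E E' : V → V → Prop} {r : V} (hE : IsDirTree E r)
    (hE' : IsDirTree E' r) (hne : ¬ ∀ w a, E' a w → E a w) :
    ∃ u v, v ≠ r ∧ E' u v ∧ ¬ E u v ∧ ¬ Descendant E v u := by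
  by_contra! hno
  refine hne fun w => ?_
  suffices h : ∀ y, Relation.ReflTransGen E' y w → ∀ a, E' a y → E a y from h w .refl
  induction hE'.reflTransGen w with
  | refl =>
    intro y hy a hay
    exact (hE'.not_transGen_self r
      ((Relation.TransGen.tail' (hE'.reflTransGen a) hay).trans_left hy)).elim
  | @tail b c _ hbc ih =>
    intro y hy a hay
    rcases hy.cases_tail with rfl | ⟨d, hyd, hdc⟩
    · obtain rfl := hE'.parent_unique hay hbc
      by_contra hn
      have hcr : c ≠ r := by
        rintro rfl
        exact hE'.not_edge_root a hbc
      have hd := descendant_iff_reflTransGen.1 (hno a c hcr hbc hn)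
      exact hE'.not_transGen_self a
        (Relation.TransGen.head' hbc (hE.reflTransGen_of_ancestors hE' ih hd))
    · obtain rfl := hE'.parent_unique hdc hbc
      exact ih y hyd a hay

/-- Any directed tree on `V` rooted at `r` can be transformed into any other by a
finite sequence of sever-graft moves: there is a sequence of triples
`(G₀, v₀, u₀), …, (G_k, v_k, u_k)` with `G₀ = G`, `G_k = G'`, each `(Gᵢ, vᵢ, uᵢ)`
(for `i < k`) in the domain of the sever-graft involution, and each `G_{i+1}`
obtained from `(Gᵢ, vᵢ, uᵢ)` by a sever-graft move. -/
theorem sever_graft_irreducible (V : Type*) [Fintype V] (r : V)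
    (E E' : V → V → Prop) (hE : IsDirTree E r) (hE' : IsDirTree E' r) :
    ∃ (k : ℕ) (Gs : Fin (k + 1) → (V → V → Prop)) (vs us : Fin k → V),
      Gs 0 = E ∧ Gs (Fin.last k) = E' ∧
      ∀ i : Fin k,
        IsDirTree (Gs i.castSucc) r ∧
        vs i ≠ r ∧
        ¬ Descendant (Gs i.castSucc) (vs i) (us i) ∧
        ∃ u' : V, Gs i.castSucc u' (vs i) ∧
          Gs i.succ = SevGraft (Gs i.castSucc) u' (us i) (vs i) := by
  induction hn : {w | ¬ ∀ a, E' a w → E a w}.ncard using Nat.strong_induction_on generalizing E with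
  | _ n ih =>
    by_cases hle : ∀ w a, E' a w → E a w
    · exact ⟨0, fun _ => E, Fin.elim0, Fin.elim0, rfl, hE.eq_of_le hE' hle, fun i => i.elim0⟩
    · obtain ⟨u, v, hv, huv, hnuv, hdesc⟩ := hE.exists_move hE' hle
      obtain ⟨u', hu'⟩ := hE.exists_parent hv
      have hlt : {w | ¬ ∀ a, E' a w → SevGraft E u' u v a w}.ncard < n := by
        rw [← hn]
        refine Set.ncard_lt_ncard ⟨?_, fun h => ?_⟩ (Set.toFinite _)
        · intro w hw hgood
          refine hw fun a ha => ?_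
          by_cases hwv : w = v
          · subst hwv
            exact .inr ⟨hE'.parent_unique ha huv, rfl⟩
          · exact .inl ⟨hgood a ha, fun h => hwv h.2⟩
        · exact h (show v ∈ {w | ¬ ∀ a, E' a w → E a w} from fun hg => hnuv (hg u huv))
            fun a ha => .inr ⟨hE'.parent_unique ha huv, rfl⟩
      obtain ⟨k, Gs, vs, us, h0, hlast, hstep⟩ :=
        ih _ hlt _ (hE.sevGraft hv hdesc hu') rfl
      refine ⟨k + 1, Fin.cons E Gs, Fin.cons v vs, Fin.cons u us, rfl, ?_, ?_⟩
      · rw [← Fin.succ_last, Fin.cons_succ, hlast]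
      · refine Fin.cases ?_ fun i => ?_
        · exact ⟨hE, hv, hdesc, u', hu', h0⟩
        · exact hstep i
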